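/- For n ≥ 50k ln k and k ≥ 50, every intersecting family F ⊆ binom([n],k) satisfies |D(F)| ≤ ∑_{ℓ=0}^{k-1} C(n-1, ℓ), with the full star attaining equality. -/

import Mathlib

open Finset

def diffFam (F : Finset (Finset ℕ)) : Finset (Finset ℕ) :=
  (F ×ˢ F).image fun p => p.1 \ p.2

def Intersecting (F : Finset (Finset ℕ)) : Prop :=
  ∀ A ∈ F, ∀ B ∈ F, (A ∩ B).Nonempty

def fullStar (n k x : ℕ) : Finset (Finset ℕ) :=
  ((Finset.Icc 1 n).powersetCard k).filter fun A => x ∈ A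


lemma exists_perm_pair {α : Type*} [Fintype α] [DecidableEq α] (P Q P' Q' : Finset α)
    (h : Disjoint P Q) (h' : Disjoint P' Q') (hP : P.card = P'.card) (hQ : Q.card = Q'.card) :
    ∃ τ : Equiv.Perm α, P.map τ.toEmbedding = P' ∧ Q.map τ.toEmbedding = Q' := by
  classical
  let e1 : P ≃ P' := Finset.equivOfCardEq hP
  let e2 : Q ≃ Q' := Finset.equivOfCardEq hQ
  let u : (P ⊕ Q) ≃ {x // x ∈ P ∪ Q} := Equiv.Finset.union P Q h
  let u' : (P' ⊕ Q') ≃ {x // x ∈ P' ∪ Q'} := Equiv.Finset.union P' Q' h'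
  let e : {x // x ∈ P ∪ Q} ≃ {x // x ∈ P' ∪ Q'} := u.symm.trans ((Equiv.sumCongr e1 e2).trans u')
  have h1 : ∀ x (hx : x ∈ P), e.extendSubtype x = (e1 ⟨x, hx⟩ : α) := by
    intro x hx
    rw [Equiv.extendSubtype_apply_of_mem e x (by simp [hx])]
    have : u.symm ⟨x, by simp [hx]⟩ = Sum.inl ⟨x, hx⟩ := by
      rw [Equiv.symm_apply_eq]; rfl
    simp only [e, Equiv.trans_apply]
    rw [this]; rfl
  have h2 : ∀ x (hx : x ∈ Q), e.extendSubtype x = (e2 ⟨x, hx⟩ : α) := by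
    intro x hx
    rw [Equiv.extendSubtype_apply_of_mem e x (by simp [hx])]
    have : u.symm ⟨x, by simp [hx]⟩ = Sum.inr ⟨x, hx⟩ := by
      rw [Equiv.symm_apply_eq]; rfl
    simp only [e, Equiv.trans_apply]
    rw [this]; rfl
  refine ⟨e.extendSubtype, ?_, ?_⟩
  · apply Finset.eq_of_subset_of_card_le
    · intro z hz
      simp only [Finset.mem_map, Equiv.coe_toEmbedding] at hz
      obtain ⟨x, hx, rfl⟩ := hz
      rw [h1 x hx]; exact (e1 ⟨x, hx⟩).2
    · simp [hP]
  · apply Finset.eq_of_subset_of_card_le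
    · intro z hz
      simp only [Finset.mem_map, Equiv.coe_toEmbedding] at hz
      obtain ⟨x, hx, rfl⟩ := hz
      rw [h2 x hx]; exact (e2 ⟨x, hx⟩).2
    · simp [hQ]

lemma sum_perm_inv {α : Type*} [Fintype α] [DecidableEq α] (m : ℕ) (σ : Equiv.Perm α)
    (g : Finset α → ℕ) :
    ∑ P ∈ powersetCard m (univ : Finset α), g (P.map σ.toEmbedding)
      = ∑ P ∈ powersetCard m (univ : Finset α), g P := by
  refine Finset.sum_equiv (Equiv.finsetCongr σ) ?_ ?_
  · intro P; simp [mem_powersetCard]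
  · intro P _; simp

lemma avg_key {α : Type*} [Fintype α] [DecidableEq α] (m : ℕ) (hm : 3 * m ≤ Fintype.card α)
    (f : Finset α → Finset α → ℕ) (hf : ∀ P Q S, f P Q ≤ f P S + f S Q) :
    (∑ P ∈ powersetCard m (univ : Finset α), ∑ Q ∈ powersetCard m (univ : Finset α), f P Q) *
      (∑ P ∈ powersetCard m (univ : Finset α), ∑ Q ∈ powersetCard m (univ : Finset α),
        if Disjoint P Q then 1 else 0) ≤
    2 * (powersetCard m (univ : Finset α)).card ^ 2 *
      ∑ P ∈ powersetCard m (univ : Finset α), ∑ Q ∈ powersetCard m (univ : Finset α),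
        if Disjoint P Q then f P Q else 0 := by
  classical
  set V := powersetCard m (univ : Finset α) with hV
  let β : Finset α → Finset α → ℕ := fun P Q =>
    ∑ σ : Equiv.Perm α, f (P.map σ.toEmbedding) (Q.map σ.toEmbedding)
  have hVc : ∀ P ∈ V, P.card = m := fun P hP => (mem_powersetCard.1 hP).2
  have hβ : ∀ P ∈ V, ∀ Q ∈ V, ∀ P' ∈ V, ∀ Q' ∈ V, Disjoint P Q → Disjoint P' Q' →
      β P Q = β P' Q' := by
    intro P hP Q hQ P' hP' Q' hQ' h h'
    obtain ⟨τ, h1, h2⟩ := exists_perm_pair P Q P' Q' h h'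
      (by rw [hVc P hP, hVc P' hP']) (by rw [hVc Q hQ, hVc Q' hQ'])
    symm
    refine Fintype.sum_equiv (Equiv.mulRight τ) _ _ ?_
    intro σ
    rw [← h1, ← h2, Finset.map_map, Finset.map_map]
    rfl
  have hb : ∃ b, ∀ P ∈ V, ∀ Q ∈ V, Disjoint P Q → β P Q = b := by
    by_cases h : ∃ P ∈ V, ∃ Q ∈ V, Disjoint P Q
    · obtain ⟨P, hP, Q, hQ, h⟩ := h
      exact ⟨β P Q, fun P' hP' Q' hQ' h' => hβ _ hP' _ hQ' _ hP _ hQ h' h⟩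
    · push Not at h
      exact ⟨0, fun P' hP' Q' hQ' h' => absurd h' (h P' hP' Q' hQ')⟩
  obtain ⟨b, hb⟩ := hb
  have h2b : ∀ P ∈ V, ∀ Q ∈ V, β P Q ≤ 2 * b := by
    intro P hP Q hQ
    have hc : m ≤ ((P ∪ Q)ᶜ).card := by
      rw [card_compl]
      have := card_union_le P Q
      rw [hVc P hP, hVc Q hQ] at this
      omega
    obtain ⟨S, hS, hSc⟩ := exists_subset_card_eq hc
    have hSV : S ∈ V := mem_powersetCard.2 ⟨subset_univ _, hSc⟩
    have hd : Disjoint (P ∪ Q) S := by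
      rw [disjoint_left]; intro a ha haS
      exact (mem_compl.1 (hS haS)) ha
    rw [disjoint_union_left] at hd
    calc β P Q ≤ β P S + β S Q := by
          simp only [β]
          rw [← sum_add_distrib]
          exact sum_le_sum fun σ _ => hf _ _ _
      _ = 2 * b := by
          rw [hb P hP S hSV hd.1, hb S hSV Q hQ hd.2.symm]; ring
  have e1 : ∑ P ∈ V, ∑ Q ∈ V, β P Q
      = Fintype.card (Equiv.Perm α) * ∑ P ∈ V, ∑ Q ∈ V, f P Q := by
    simp only [β]
    have : ∀ P ∈ V, ∑ Q ∈ V, ∑ σ : Equiv.Perm α, f (P.map σ.toEmbedding) (Q.map σ.toEmbedding)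
       = ∑ σ : Equiv.Perm α, ∑ Q ∈ V, f (P.map σ.toEmbedding) Q := by
      intro P _
      rw [sum_comm]
      refine sum_congr rfl fun σ _ => ?_
      exact sum_perm_inv m σ (fun Q => f (P.map σ.toEmbedding) Q)
    rw [sum_congr rfl this, sum_comm]
    rw [sum_congr rfl (fun σ _ => sum_perm_inv m σ (fun P => ∑ Q ∈ V, f P Q))]
    simp
    rfl
  have e2 : b * (∑ P ∈ V, ∑ Q ∈ V, if Disjoint P Q then 1 else 0)
      = Fintype.card (Equiv.Perm α) * ∑ P ∈ V, ∑ Q ∈ V, if Disjoint P Q then f P Q else 0 := by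
    have h1 : b * (∑ P ∈ V, ∑ Q ∈ V, if Disjoint P Q then 1 else 0)
        = ∑ P ∈ V, ∑ Q ∈ V, ∑ σ : Equiv.Perm α,
          if Disjoint (P.map σ.toEmbedding) (Q.map σ.toEmbedding)
          then f (P.map σ.toEmbedding) (Q.map σ.toEmbedding) else 0 := by
      rw [mul_sum]
      refine sum_congr rfl fun P hP => ?_
      rw [mul_sum]
      refine sum_congr rfl fun Q hQ => ?_
      simp only [disjoint_map]
      split_ifs with h
      · rw [mul_one, ← hb P hP Q hQ h]
      · simp
    rw [h1]
    have : ∀ P ∈ V, ∑ Q ∈ V, ∑ σ : Equiv.Perm α, 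
          (if Disjoint (P.map σ.toEmbedding) (Q.map σ.toEmbedding)
          then f (P.map σ.toEmbedding) (Q.map σ.toEmbedding) else 0)
       = ∑ σ : Equiv.Perm α, ∑ Q ∈ V, if Disjoint (P.map σ.toEmbedding) Q then
         f (P.map σ.toEmbedding) Q else 0 := by
      intro P _
      rw [sum_comm]
      refine sum_congr rfl fun σ _ => ?_
      exact sum_perm_inv m σ (fun Q => if Disjoint (P.map σ.toEmbedding) Q then
         f (P.map σ.toEmbedding) Q else 0)
    rw [sum_congr rfl this, sum_comm]
    rw [sum_congr rfl (fun σ _ => sum_perm_inv m σ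
      (fun P => ∑ Q ∈ V, if Disjoint P Q then f P Q else 0))]
    simp only [sum_const, card_univ, smul_eq_mul]
    rfl
  have e3 : ∑ P ∈ V, ∑ Q ∈ V, β P Q ≤ V.card ^ 2 * (2 * b) := by
    calc _ ≤ ∑ P ∈ V, ∑ Q ∈ V, 2 * b :=
          sum_le_sum fun P hP => sum_le_sum fun Q hQ => h2b P hP Q hQ
      _ = _ := by simp only [sum_const, smul_eq_mul]; ring
  have hpos : 0 < Fintype.card (Equiv.Perm α) := Fintype.card_pos
  set D := ∑ P ∈ V, ∑ Q ∈ V, if Disjoint P Q then 1 else 0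
  set S1 := ∑ P ∈ V, ∑ Q ∈ V, f P Q
  set S2 := ∑ P ∈ V, ∑ Q ∈ V, if Disjoint P Q then f P Q else 0
  refine Nat.le_of_mul_le_mul_left ?_ hpos
  calc _ = (Fintype.card (Equiv.Perm α) * S1) * D := by ring
    _ ≤ (V.card ^ 2 * (2 * b)) * D := by rw [← e1]; exact Nat.mul_le_mul_right _ e3
    _ = 2 * V.card ^ 2 * (b * D) := by ring
    _ = _ := by rw [e2]; ring

lemma avg_key' (S : Finset ℕ) (m : ℕ) (hm : 3 * m ≤ S.card)
    (f : Finset ℕ → Finset ℕ → ℕ) (hf : ∀ P Q S, f P Q ≤ f P S + f S Q) :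
    (∑ P ∈ powersetCard m S, ∑ Q ∈ powersetCard m S, f P Q) *
      (∑ P ∈ powersetCard m S, ∑ Q ∈ powersetCard m S,
        if Disjoint P Q then 1 else 0) ≤
    2 * (powersetCard m S).card ^ 2 *
      ∑ P ∈ powersetCard m S, ∑ Q ∈ powersetCard m S,
        if Disjoint P Q then f P Q else 0 := by
  have hS : S = (univ : Finset S).map (Function.Embedding.subtype (· ∈ S)) := by
    ext; simp
  have h := avg_key (α := S) m (by simpa using hm)
    (fun P Q => f (P.map (Function.Embedding.subtype (· ∈ S)))
      (Q.map (Function.Embedding.subtype (· ∈ S)))) (fun P Q S => hf _ _ _)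
  have hps : powersetCard m S = (powersetCard m (univ : Finset S)).map
      (mapEmbedding (Function.Embedding.subtype (· ∈ S))).toEmbedding := by
    rw [← powersetCard_map, ← hS]
  rw [hps]
  simp only [sum_map, card_map, RelEmbedding.coe_toEmbedding, mapEmbedding_apply, disjoint_map]
  exact h

lemma kk_nat (M m r s : ℕ) (C : Finset (Finset ℕ)) (hC : ∀ c ∈ C, c ⊆ range M ∧ c.card = r)
    (hs : s ≤ r) (hrm : r ≤ m) (hm : m ≤ M) (h : m.choose r ≤ C.card) (H : Finset (Finset ℕ))
    (hH : ∀ c ∈ C, ∀ E ⊆ c, E.card = s → E ∈ H) : m.choose s ≤ H.card := by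
  classical
  let g : Finset ℕ → Finset (Fin M) := fun c => univ.filter fun i : Fin M => (i : ℕ) ∈ c
  have hg : ∀ c ⊆ range M, (g c).map Fin.valEmbedding = c := by
    intro c hc
    ext a
    simp only [g, mem_map, mem_filter, mem_univ, true_and, Fin.valEmbedding_apply]
    constructor
    · rintro ⟨i, hi, rfl⟩; exact hi
    · intro ha; exact ⟨⟨a, mem_range.1 (hc ha)⟩, ha, rfl⟩
  have hinj : Set.InjOn g C := by
    intro c hc d hd hcd
    rw [← hg c (hC c hc).1, ← hg d (hC d hd).1, hcd]
  have hcard : (C.image g).card = C.card := card_image_of_injOn hinj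
  have hsz : ((C.image g : Finset (Finset (Fin M))) : Set (Finset (Fin M))).Sized r := by
    intro d hd
    simp only [coe_image, Set.mem_image, mem_coe] at hd
    obtain ⟨c, hc, rfl⟩ := hd
    rw [← card_map Fin.valEmbedding, hg c (hC c hc).1, (hC c hc).2]
  have hk := Finset.kruskal_katona_lovasz_form (i := r - s) (r := r) (k := m) (n := M)
    (𝒜 := C.image g) (Nat.sub_le _ _) hrm hm hsz (by rw [hcard]; exact h)
  rw [Nat.sub_sub_self hs] at hk
  refine hk.trans ?_
  rw [← card_map (mapEmbedding (Fin.valEmbedding (n := M))).toEmbedding]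
  apply card_le_card
  intro E hE
  rw [mem_map] at hE
  obtain ⟨e, he, rfl⟩ := hE
  rw [mem_shadow_iterate_iff_exists_mem_card_add] at he
  obtain ⟨d, hd, hed, hcd⟩ := he
  have hdr := hsz hd
  rw [mem_image] at hd
  obtain ⟨c, hc, rfl⟩ := hd
  refine hH c hc _ ?_ ?_
  · rw [RelEmbedding.coe_toEmbedding, mapEmbedding_apply]
    conv_rhs => rw [← hg c (hC c hc).1]
    exact map_subset_map.2 hed
  · rw [RelEmbedding.coe_toEmbedding, mapEmbedding_apply, card_map]
    omega

/-- the `j`-subsets of `X` disjoint from some member of `B` -/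
noncomputable def hFam (X : Finset ℕ) (B : Finset (Finset ℕ)) (j : ℕ) : Finset (Finset ℕ) :=
  by classical exact (powersetCard j X).filter fun E => ∃ G ∈ B, Disjoint E G

lemma mem_hFam {X : Finset ℕ} {B : Finset (Finset ℕ)} {j : ℕ} {E : Finset ℕ} :
    E ∈ hFam X B j ↔ (E ⊆ X ∧ E.card = j) ∧ ∃ G ∈ B, Disjoint E G := by
  classical
  simp [hFam, mem_powersetCard]

lemma hFam_kk (X : Finset ℕ) (B : Finset (Finset ℕ)) (k t s M : ℕ) (hX : X ⊆ range M)
    (hB : B ⊆ powersetCard k X) (ht : t ≤ k) (hk : k ≤ X.card) (hs : s ≤ X.card - k)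
    (h : (X.card - t).choose (k - t) ≤ B.card) :
    (X.card - t).choose s ≤ (hFam X B s).card := by
  classical
  have hB' : ∀ b ∈ B, b ⊆ X ∧ b.card = k := fun b hb => mem_powersetCard.1 (hB hb)
  have hinj : Set.InjOn (fun b => X \ b) (B : Set (Finset ℕ)) := by
    intro b hb c hc hbc
    have : X \ (X \ b) = X \ (X \ c) := by simp only at hbc; rw [hbc]
    rwa [Finset.sdiff_sdiff_eq_self (hB' b hb).1, Finset.sdiff_sdiff_eq_self (hB' c hc).1] at this
  have hXM : X.card ≤ M := by simpa using card_le_card hX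
  refine kk_nat M (X.card - t) (X.card - k) s (B.image fun b => X \ b) ?_ hs (by omega)
    (by omega) ?_ _ ?_
  · intro c hc
    obtain ⟨b, hb, rfl⟩ := mem_image.1 hc
    refine ⟨sdiff_subset.trans hX, ?_⟩
    rw [card_sdiff_of_subset (hB' b hb).1, (hB' b hb).2]
  · rw [card_image_of_injOn hinj]
    have : (X.card - t).choose (X.card - k) = (X.card - t).choose (k - t) := by
      rw [← Nat.choose_symm (by omega)]
      congr 1; omega
    rw [this]; exact h
  · intro c hc E hE hEs
    obtain ⟨b, hb, rfl⟩ := mem_image.1 hc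
    rw [mem_hFam]
    refine ⟨⟨hE.trans sdiff_subset, hEs⟩, b, hb, ?_⟩
    rw [disjoint_left]
    intro a ha hab
    exact (mem_sdiff.1 (hE ha)).2 hab

lemma hFam_step (X : Finset ℕ) (B : Finset (Finset ℕ)) (k j : ℕ)
    (hB : B ⊆ powersetCard k X) :
    (hFam X B j).card * (X.card - k - j) ≤ (hFam X B (j + 1)).card * (j + 1) := by
  classical
  refine card_mul_le_card_mul (fun E E' : Finset ℕ => E ⊆ E') ?_ ?_
  · intro E hE
    obtain ⟨⟨hEX, hEj⟩, G, hG, hd⟩ := mem_hFam.1 hE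
    obtain ⟨hGX, hGk⟩ := mem_powersetCard.1 (hB hG)
    have hc : X.card - k - j ≤ ((X \ G) \ E).card := by
      have h1 := le_card_sdiff G X
      have h2 := le_card_sdiff E (X \ G)
      omega
    refine hc.trans ?_
    refine card_le_card_of_injOn (fun a => insert a E) ?_ ?_
    · intro a ha
      simp only [coe_sdiff, Set.mem_sdiff, mem_coe] at ha
      simp only [bipartiteAbove, coe_filter, Set.mem_ofPred_eq, subset_insert, and_true]
      rw [mem_hFam]
      refine ⟨⟨insert_subset ha.1.1 hEX, by rw [card_insert_of_notMem ha.2, hEj]⟩, G, hG, ?_⟩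
      rw [disjoint_insert_left]; exact ⟨ha.1.2, hd⟩
    · intro a ha b hb hab
      simp only [coe_sdiff, Set.mem_sdiff, mem_coe] at ha hb
      simp only at hab
      have : a ∈ insert b E := hab ▸ mem_insert_self a E
      rcases mem_insert.1 this with h | h
      · exact h
      · exact absurd h ha.2
  · intro E' hE'
    obtain ⟨⟨hEX, hEj⟩, G, hG, hd⟩ := mem_hFam.1 hE'
    calc _ ≤ (powersetCard j E').card := by
          apply card_le_card
          intro E hE
          simp only [bipartiteBelow, mem_filter, mem_hFam] at hE
          exact mem_powersetCard.2 ⟨hE.2, hE.1.1.2⟩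
      _ = j + 1 := by rw [card_powersetCard, hEj]; simp

lemma hFam_sum (X : Finset ℕ) (B : Finset (Finset ℕ)) (k m : ℕ)
    (hB : B ⊆ powersetCard k X) (hm : 4 * m + k ≤ X.card) :
    2 * ∑ j ∈ range m, (hFam X B j).card ≤ (hFam X B m).card := by
  induction m with
  | zero => simp
  | succ m ih =>
    have h1 := ih (by omega)
    have h2 := hFam_step X B k m hB
    have h3 : 3 * (m + 1) ≤ X.card - k - m := by omega
    have h4 : (hFam X B m).card * 3 ≤ (hFam X B (m + 1)).card := by
      refine Nat.le_of_mul_le_mul_right (c := m + 1) ?_ (by omega)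
      calc _ = (hFam X B m).card * (3 * (m + 1)) := by ring
        _ ≤ _ := (Nat.mul_le_mul_left _ h3).trans h2
    rw [sum_range_succ]; omega

lemma sdiff_card_lt {A B : Finset ℕ} (h : (A ∩ B).Nonempty) : (A \ B).card + 1 ≤ A.card := by
  have := card_sdiff_add_card_inter A B
  have := h.card_pos
  omega

lemma card_small (X : Finset ℕ) (m : ℕ) :
    ((range m).biUnion fun j => powersetCard j X).card = ∑ j ∈ range m, X.card.choose j := by
  rw [card_biUnion]
  · simp
  · intro i _ j _ hij
    exact pairwise_disjoint_powersetCard X hij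

lemma mem_small {X : Finset ℕ} {m : ℕ} {E : Finset ℕ} :
    E ∈ ((range m).biUnion fun j => powersetCard j X) ↔ E ⊆ X ∧ E.card < m := by
  simp only [mem_biUnion, mem_range, mem_powersetCard]
  constructor
  · rintro ⟨j, hj, h, rfl⟩; exact ⟨h, hj⟩
  · rintro ⟨h, h'⟩; exact ⟨_, h', h, rfl⟩

lemma degree_add (S : Finset ℕ) (k x : ℕ) (F : Finset (Finset ℕ))
    (hI : Intersecting F) :
    ((powersetCard (k - 1) (S.erase x)).filter fun E => insert x E ∈ F).card
      + (hFam (S.erase x) (F.filter fun A => x ∉ A) (k - 1)).card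
      ≤ (S.erase x).card.choose (k - 1) := by
  classical
  rw [← card_powersetCard, ← card_union_of_disjoint]
  · apply card_le_card
    apply union_subset (filter_subset _ _)
    intro E hE
    exact mem_powersetCard.2 (mem_hFam.1 hE).1
  · rw [disjoint_left]
    intro E hE hE'
    obtain ⟨_, G, hG, hd⟩ := mem_hFam.1 hE'
    rw [mem_filter] at hE hG
    obtain ⟨a, ha⟩ := hI _ hE.2 _ hG.1
    rw [mem_inter, mem_insert] at ha
    rcases ha.1 with h | h
    · exact hG.2 (h ▸ ha.2)
    · exact disjoint_left.1 hd h ha.2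

lemma case_one (S : Finset ℕ) (k x : ℕ) (hk : 2 ≤ k) (hS : 6 * k ≤ S.card)
    (hx : x ∈ S) (F : Finset (Finset ℕ))
    (hF : F ⊆ powersetCard k S) (hI : Intersecting F)
    (hB : 2 * (k * (F.filter fun A => x ∉ A).card)
      ≤ (hFam (S.erase x) (F.filter fun A => x ∉ A) (k - 1)).card) :
    (diffFam F).card ≤ ∑ ℓ ∈ range k, (S.card - 1).choose ℓ := by
  classical
  set X := S.erase x with hX
  set B := F.filter fun A => x ∉ A with hBdef
  have hXc : X.card = S.card - 1 := card_erase_of_mem hx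
  have hF' : ∀ A ∈ F, A ⊆ S ∧ A.card = k := fun A hA => mem_powersetCard.1 (hF hA)
  have hBX : B ⊆ powersetCard k X := by
    intro A hA
    rw [hBdef, mem_filter] at hA
    exact mem_powersetCard.2 ⟨subset_erase.2 ⟨(hF' A hA.1).1, hA.2⟩, (hF' A hA.1).2⟩
  let A := (powersetCard (k - 1) X).filter fun E => insert x E ∈ F
  let Dl := (range (k - 1)).biUnion fun j => powersetCard j X
  let DB := B.biUnion fun G => powersetCard (k - 1) G
  let D1 := ((range (k - 1)).biUnion fun j => hFam X B j).image fun E => insert x E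
  have hsub : diffFam F ⊆ Dl ∪ (A ∪ DB) ∪ D1 := by
    intro E hE
    obtain ⟨⟨P, Q⟩, hPQ, rfl⟩ := mem_image.1 hE
    rw [mem_product] at hPQ
    obtain ⟨hP, hQ⟩ := hPQ
    simp only at hP hQ ⊢
    have hlt := sdiff_card_lt (hI P hP Q hQ)
    rw [(hF' P hP).2] at hlt
    by_cases hxE : x ∈ P \ Q
    · refine mem_union_right _ (mem_image.2 ⟨(P \ Q).erase x, ?_, insert_erase hxE⟩)
      rw [mem_biUnion]
      have hc := card_erase_of_mem hxE
      have hpos : 0 < (P \ Q).card := card_pos.2 ⟨x, hxE⟩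
      refine ⟨_, ?_, mem_hFam.2 ⟨⟨erase_subset_erase _ (sdiff_subset.trans (hF' P hP).1), rfl⟩,
        Q, mem_filter.2 ⟨hQ, (mem_sdiff.1 hxE).2⟩, ?_⟩⟩
      · rw [mem_range]; omega
      · exact disjoint_of_subset_left (erase_subset _ _) sdiff_disjoint
    · refine mem_union_left _ ?_
      have hEX : P \ Q ⊆ X := subset_erase.2 ⟨sdiff_subset.trans (hF' P hP).1, hxE⟩
      by_cases hc : (P \ Q).card < k - 1
      · exact mem_union_left _ (mem_small.2 ⟨hEX, hc⟩)
      · have hc' : (P \ Q).card = k - 1 := by omega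
        refine mem_union_right _ ?_
        by_cases hxP : x ∈ P
        · refine mem_union_left _ (mem_filter.2 ⟨mem_powersetCard.2 ⟨hEX, hc'⟩, ?_⟩)
          have : insert x (P \ Q) = P := by
            apply eq_of_subset_of_card_le
            · exact insert_subset hxP sdiff_subset
            · rw [card_insert_of_notMem hxE, hc', (hF' P hP).2]; omega
          rw [this]; exact hP
        · exact mem_union_right _ (mem_biUnion.2 ⟨P, mem_filter.2 ⟨hP, hxP⟩,
            mem_powersetCard.2 ⟨sdiff_subset, hc'⟩⟩)
  have h1 := card_le_card hsub
  have h2 := card_union_le (Dl ∪ (A ∪ DB)) D1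
  have h3 := card_union_le Dl (A ∪ DB)
  have h4 := card_union_le A DB
  have h5 : Dl.card = ∑ j ∈ range (k - 1), X.card.choose j := card_small X (k - 1)
  have h6 : DB.card ≤ B.card * k := by
    refine card_biUnion_le_card_mul _ _ _ ?_
    intro G hG
    rw [card_powersetCard, (mem_powersetCard.1 (hBX hG)).2]
    obtain ⟨k', rfl⟩ : ∃ k', k = k' + 1 := ⟨k - 1, by omega⟩
    simp
  have h7 : D1.card ≤ ∑ j ∈ range (k - 1), (hFam X B j).card :=
    card_image_le.trans card_biUnion_le
  have h8 := hFam_sum X B k (k - 1) hBX (by omega)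
  have h9 := degree_add S k x F hI
  change A.card + (hFam X B (k - 1)).card ≤ X.card.choose (k - 1) at h9
  have h10 : ∑ ℓ ∈ range k, (S.card - 1).choose ℓ
      = ∑ j ∈ range (k - 1), X.card.choose j + X.card.choose (k - 1) := by
    rw [← sum_range_succ, hXc]
    congr 2; omega
  rw [h10]
  have h11 : B.card * k = k * B.card := mul_comm _ _
  omega

lemma choose_pow (M q k d : ℕ) (hM : q * k + k ≤ M) (j : ℕ) (hj : j + d ≤ k) :
    q ^ d * M.choose j ≤ M.choose (j + d) := by
  induction d with
  | zero => simp
  | succ d ih =>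
    have h1 := ih (by omega)
    have h2 := Nat.choose_succ_right_eq M (j + d)
    have h3 : q * (j + d + 1) ≤ M - (j + d) := by
      have : q * (j + d + 1) ≤ q * k := Nat.mul_le_mul_left _ (by omega)
      omega
    have h4 : q * M.choose (j + d) ≤ M.choose (j + d + 1) := by
      refine Nat.le_of_mul_le_mul_right (c := j + d + 1) ?_ (by omega)
      rw [h2]
      calc _ = M.choose (j + d) * (q * (j + d + 1)) := by ring
        _ ≤ _ := Nat.mul_le_mul_left _ h3
    calc q ^ (d + 1) * M.choose j = q * (q ^ d * M.choose j) := by ring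
      _ ≤ q * M.choose (j + d) := Nat.mul_le_mul_left _ h1
      _ ≤ _ := h4

lemma choose_succ_le_two (M j : ℕ) (h : 2 * j ≤ M) : (M + 1).choose j ≤ 2 * M.choose j := by
  cases j with
  | zero => simp
  | succ j =>
    rw [Nat.choose_succ_succ']
    have := Nat.choose_le_succ_of_lt_half_left (n := M) (r := j) (by omega)
    omega

lemma numeric_one (n k L t : ℕ) (hL : 5 ≤ L) (hkL : k < 2 ^ (L + 1)) (hn : 70 * k ≤ n)
    (hk : 50 ≤ k) (ht : L < t) (htk : t ≤ k) :
    2 * (k * (n - t).choose (k - t + 1)) ≤ (n - 1 - t).choose (k - 1) := by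
  obtain ⟨M, hM⟩ : ∃ M, n - t = M + 1 := ⟨n - t - 1, by omega⟩
  have hM' : n - 1 - t = M := by omega
  rw [hM, hM']
  have h1 := choose_succ_le_two M (k - t + 1) (by omega)
  have h2 := choose_pow M 64 k (t - 2) (by omega) (k - t + 1) (by omega)
  rw [show k - t + 1 + (t - 2) = k - 1 by omega] at h2
  have h3 : 4 * k ≤ 64 ^ (t - 2) := by
    have : (64 : ℕ) ^ (t - 2) = 2 ^ (6 * (t - 2)) := by rw [pow_mul]; norm_num
    rw [this]
    calc 4 * k ≤ 4 * 2 ^ (L + 1) := by omega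
      _ = 2 ^ (L + 3) := by ring
      _ ≤ _ := Nat.pow_le_pow_right (by norm_num) (by omega)
  calc _ ≤ 2 * (k * (2 * M.choose (k - t + 1))) := by gcongr
    _ = 4 * k * M.choose (k - t + 1) := by ring
    _ ≤ 64 ^ (t - 2) * M.choose (k - t + 1) := Nat.mul_le_mul_right _ h3
    _ ≤ _ := h2

lemma case_one' (S : Finset ℕ) (k x L : ℕ) (hk : 50 ≤ k) (hS : 70 * k ≤ S.card)
    (hL : 5 ≤ L) (hLk : L ≤ k) (hkL : k < 2 ^ (L + 1))
    (hx : x ∈ S) (F : Finset (Finset ℕ))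
    (hF : F ⊆ powersetCard k S) (hI : Intersecting F)
    (hB : (F.filter fun A => x ∉ A).card < (S.card - 1 - L).choose (k - L)) :
    (diffFam F).card ≤ ∑ ℓ ∈ range k, (S.card - 1).choose ℓ := by
  classical
  refine case_one S k x (by omega) (by omega) hx F hF hI ?_
  set B := F.filter fun A => x ∉ A with hBdef
  have hXc : (S.erase x).card = S.card - 1 := card_erase_of_mem hx
  rcases Nat.eq_zero_or_pos B.card with h0 | hpos
  · rw [h0]; simp
  have hBX : B ⊆ powersetCard k (S.erase x) := by
    intro A hA
    rw [hBdef, mem_filter] at hA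
    have := mem_powersetCard.1 (hF hA.1)
    exact mem_powersetCard.2 ⟨subset_erase.2 ⟨this.1, hA.2⟩, this.2⟩
  have hex : ∃ t, L ≤ t ∧ (S.card - 1 - t).choose (k - t) ≤ B.card :=
    ⟨k, hLk, by simpa using hpos⟩
  let t := Nat.find hex
  obtain ⟨hLt, htB⟩ : L ≤ t ∧ (S.card - 1 - t).choose (k - t) ≤ B.card := Nat.find_spec hex
  have htk : t ≤ k := Nat.find_min' hex ⟨hLk, by simpa using hpos⟩
  have hne : t ≠ L := by
    intro h; rw [h] at htB; omega
  have hmin := Nat.find_min hex (m := t - 1) (by change t - 1 < t; omega)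
  push Not at hmin
  have h1 := hmin (by omega)
  rw [show S.card - 1 - (t - 1) = S.card - t by omega, show k - (t - 1) = k - t + 1 by omega] at h1
  obtain ⟨M, hM⟩ : ∃ M, S.erase x ⊆ range M := by
    obtain ⟨M, hM⟩ := exists_nat_subset_range (S.erase x); exact ⟨M, hM⟩
  have h2 := hFam_kk (S.erase x) B k t (k - 1) M hM hBX htk (by omega) (by omega)
    (by rw [hXc]; exact htB)
  rw [hXc] at h2
  have h3 := numeric_one S.card k L t hL hkL hS hk (by omega) htk
  calc 2 * (k * B.card) ≤ 2 * (k * (S.card - t).choose (k - t + 1)) := by gcongr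
    _ ≤ _ := h3.trans h2

lemma choose_drop (M L m : ℕ) :
    (M + L).choose (m + 1) ≤ M.choose (m + 1) + L * (M + L).choose m := by
  induction L with
  | zero => simp
  | succ L ih =>
    have h1 : (M + (L + 1)).choose (m + 1) = (M + L).choose m + (M + L).choose (m + 1) :=
      Nat.choose_succ_succ' (M + L) m
    have h2 : (M + L).choose m ≤ (M + (L + 1)).choose m := Nat.choose_le_choose m (by omega)
    have h3 : L * (M + L).choose m ≤ L * (M + (L + 1)).choose m := Nat.mul_le_mul_left _ h2
    rw [h1, Nat.add_mul, Nat.one_mul]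
    omega

lemma sum_choose_small (n k m : ℕ) (hn : 101 * k + k ≤ n) (hm : m ≤ k) :
    100 * ∑ j ∈ range m, n.choose j ≤ n.choose m := by
  induction m with
  | zero => simp
  | succ m ih =>
    have h1 := ih (by omega)
    have h2 := choose_pow n 101 k 1 hn m hm
    rw [sum_range_succ]; omega

lemma card_disj (S P : Finset ℕ) (m : ℕ) (hP : P ∈ powersetCard m S) :
    (∑ Q ∈ powersetCard m S, if Disjoint P Q then 1 else 0) = (S.card - m).choose m := by
  have hP' := mem_powersetCard.1 hP
  rw [← card_filter]
  have : (powersetCard m S).filter (fun Q => Disjoint P Q) = powersetCard m (S \ P) := by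
    ext Q
    simp only [mem_filter, mem_powersetCard, subset_sdiff]
    constructor
    · rintro ⟨⟨h1, h2⟩, h3⟩; exact ⟨⟨h1, h3.symm⟩, h2⟩
    · rintro ⟨⟨h1, h2⟩, h3⟩; exact ⟨⟨h1, h3⟩, h2.symm⟩
  rw [this, card_powersetCard, card_sdiff_of_subset hP'.1, hP'.2]

lemma card_disj_mem (S P : Finset ℕ) (m y : ℕ) (hP : P ∈ powersetCard m S) (hy : y ∈ S)
    (hyP : y ∉ P) :
    (∑ Q ∈ powersetCard m S, if Disjoint P Q ∧ y ∈ Q then 1 else 0)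
      ≤ (S.card - m - 1).choose (m - 1) := by
  have hP' := mem_powersetCard.1 hP
  rw [← card_filter]
  have hc : ((S \ P).erase y).card = S.card - m - 1 := by
    rw [card_erase_of_mem (mem_sdiff.2 ⟨hy, hyP⟩), card_sdiff_of_subset hP'.1, hP'.2]
  rw [← hc, ← card_powersetCard]
  refine card_le_card_of_injOn (fun Q => Q.erase y) ?_ ?_
  · intro Q hQ
    simp only [coe_filter, Set.mem_ofPred_eq, mem_powersetCard] at hQ
    obtain ⟨⟨h1, h2⟩, h3, h4⟩ := hQ
    simp only [mem_coe, mem_powersetCard]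
    refine ⟨erase_subset_erase _ (subset_sdiff.2 ⟨h1, h3.symm⟩), ?_⟩
    rw [card_erase_of_mem h4, h2]
  · intro Q hQ Q' hQ' h
    simp only [coe_filter, Set.mem_ofPred_eq] at hQ hQ'
    simp only at h
    rw [← insert_erase hQ.2.2, h, insert_erase hQ'.2.2]

lemma case_two (S : Finset ℕ) (k L : ℕ) (hk : 50 ≤ k) (hS : 34 * k * L ≤ S.card)
    (hL : 5 ≤ L) (hLk : L ≤ k) (F : Finset (Finset ℕ))
    (hF : F ⊆ powersetCard k S) (hI : Intersecting F)
    (hB : ∀ x ∈ S, (S.card - 1 - L).choose (k - L) ≤ (F.filter fun A => x ∉ A).card) :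
    (diffFam F).card ≤ ∑ ℓ ∈ range k, (S.card - 1).choose ℓ := by
  classical
  have hF' : ∀ A ∈ F, A ⊆ S ∧ A.card = k := fun A hA => mem_powersetCard.1 (hF hA)
  set n := S.card with hn
  have hn170 : 170 * k ≤ n := by nlinarith
  obtain ⟨m, rfl⟩ : ∃ m, k = m + 2 := ⟨k - 2, by omega⟩
  set N := n.choose (m + 1) with hN
  have hsucc : n * (n - 1).choose m = N * (m + 1) := by
    have := Nat.add_one_mul_choose_eq (n - 1) m
    rwa [Nat.sub_add_cancel (by omega)] at this
  have hnpos : 0 < n := by omega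
  have hNpos : 0 < N := Nat.choose_pos (by omega)
  -- degrees are small
  have hdeg : ∀ y ∈ S, 34 * ((powersetCard (m + 1) (S.erase y)).filter
      fun E => insert y E ∈ F).card ≤ N := by
    intro y hy
    have hXc : (S.erase y).card = n - 1 := card_erase_of_mem hy
    obtain ⟨M, hM⟩ := exists_nat_subset_range (S.erase y)
    have hBX : (F.filter fun A => y ∉ A) ⊆ powersetCard (m + 2) (S.erase y) := by
      intro A hA
      rw [mem_filter] at hA
      have := hF' A hA.1
      exact mem_powersetCard.2 ⟨subset_erase.2 ⟨this.1, hA.2⟩, this.2⟩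
    have h1 := hFam_kk (S.erase y) _ (m + 2) L (m + 1) M hM hBX hLk (by omega) (by omega)
      (by rw [hXc]; exact hB y hy)
    have h2 := degree_add S (m + 2) y F hI
    rw [hXc] at h1 h2
    rw [show m + 2 - 1 = m + 1 by omega] at h2
    have h3 := choose_drop (n - 1 - L) L m
    rw [show n - 1 - L + L = n - 1 by omega] at h3
    set a := ((powersetCard (m + 1) (S.erase y)).filter fun E => insert y E ∈ F).card
    have h4 : a ≤ L * (n - 1).choose m := by omega
    refine Nat.le_of_mul_le_mul_left ?_ hnpos
    calc n * (34 * a) ≤ n * (34 * (L * (n - 1).choose m)) := by gcongr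
      _ = 34 * L * (n * (n - 1).choose m) := by ring
      _ = 34 * (m + 1) * L * N := by rw [hsucc]; ring
      _ ≤ n * N := by
        refine Nat.mul_le_mul_right _ (le_trans ?_ hS)
        gcongr; omega
  -- good sets
  let good : Finset ℕ → Prop := fun E => ∃ y, y ∈ S ∧ y ∉ E ∧ insert y E ∈ F
  let yf : Finset ℕ → ℕ := fun E => if h : good E then h.choose else 0
  have hyf : ∀ E, good E → yf E ∈ S ∧ yf E ∉ E ∧ insert (yf E) E ∈ F := by
    intro E h
    simp only [yf, dif_pos h]
    exact h.choose_spec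
  set V := powersetCard (m + 1) S with hV
  have hVc : V.card = N := by rw [hV, card_powersetCard]
  set g := (V.filter good).card with hg
  set bad := (V.filter fun E => ¬ good E).card with hbad
  have hgb : g + bad = N := by
    rw [hg, hbad, card_filter_add_card_filter_not, hVc]
  -- differences
  have hD : (diffFam F).card ≤ ∑ j ∈ range (m + 1), n.choose j + g := by
    rw [hn, ← card_small S (m + 1)]
    refine le_trans (card_le_card ?_) (card_union_le _ _)
    intro E hE
    obtain ⟨⟨P, Q⟩, hPQ, rfl⟩ := mem_image.1 hE
    rw [mem_product] at hPQ
    obtain ⟨hP, hQ⟩ := hPQ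
    simp only at hP hQ ⊢
    have hlt := sdiff_card_lt (hI P hP Q hQ)
    rw [(hF' P hP).2] at hlt
    have hEX : P \ Q ⊆ S := sdiff_subset.trans (hF' P hP).1
    by_cases hc : (P \ Q).card < m + 1
    · exact mem_union_left _ (mem_small.2 ⟨hEX, hc⟩)
    · have hc' : (P \ Q).card = m + 1 := by omega
      refine mem_union_right _ (mem_filter.2 ⟨mem_powersetCard.2 ⟨hEX, hc'⟩, ?_⟩)
      obtain ⟨y, hy⟩ := hI P hP Q hQ
      rw [mem_inter] at hy
      have hyE : y ∉ P \ Q := fun h => (mem_sdiff.1 h).2 hy.2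
      refine ⟨y, (hF' P hP).1 hy.1, hyE, ?_⟩
      have : insert y (P \ Q) = P := by
        apply eq_of_subset_of_card_le
        · exact insert_subset hy.1 sdiff_subset
        · rw [card_insert_of_notMem hyE, hc', (hF' P hP).2]
      rw [this]; exact hP
  by_contra hcon
  push Not at hcon
  have hs1 := sum_choose_small n (m + 2) (m + 1) (by omega) (by omega)
  have hs2 : (n - 1).choose (m + 1) ≤ ∑ ℓ ∈ range (m + 2), (n - 1).choose ℓ :=
    single_le_sum (f := fun ℓ => (n - 1).choose ℓ) (fun _ _ => Nat.zero_le _) (by simp)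
  have hs3 : N = (n - 1).choose m + (n - 1).choose (m + 1) := by
    have := Nat.choose_succ_succ' (n - 1) m
    rwa [Nat.sub_add_cancel (by omega)] at this
  have hs4 : 100 * (n - 1).choose m ≤ N := by
    refine Nat.le_of_mul_le_mul_right (c := m + 1) ?_ (by omega)
    rw [← hsucc]
    calc _ = (100 * (m + 1)) * (n - 1).choose m := by ring
      _ ≤ _ := Nat.mul_le_mul_right _ (by omega)
  have hbadN : 50 * bad ≤ N := by
    rw [← hN] at hs1; omega
  -- the pseudo-metric
  let f : Finset ℕ → Finset ℕ → ℕ := fun P Q =>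
    if good P ∧ good Q ∧ yf P = yf Q then 0 else 1
  have hft : ∀ P Q R, f P Q ≤ f P R + f R Q := by
    intro P Q R
    simp only [f]
    by_cases h1 : good P ∧ good R ∧ yf P = yf R
    · by_cases h2 : good R ∧ good Q ∧ yf R = yf Q
      · rw [if_pos ⟨h1.1, h2.2.1, h1.2.2.trans h2.2.2⟩]; omega
      · rw [if_neg h2]; split_ifs <;> omega
    · rw [if_neg h1]; split_ifs <;> omega
  have hkey := avg_key' S (m + 1) (by omega) f hft
  set K := (n - (m + 1)).choose (m + 1) with hK
  set c := (n - (m + 1) - 1).choose (m + 1 - 1) with hc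
  have hKpos : 0 < K := Nat.choose_pos (by omega)
  have hcK : 100 * c ≤ K := by
    have h1 := Nat.add_one_mul_choose_eq (n - (m + 1) - 1) (m + 1 - 1)
    rw [Nat.sub_add_cancel (by omega), Nat.sub_add_cancel (by omega), ← hK, ← hc] at h1
    refine Nat.le_of_mul_le_mul_right (c := m + 1) ?_ (by omega)
    rw [← h1]
    calc _ = (100 * (m + 1)) * c := by ring
      _ ≤ _ := Nat.mul_le_mul_right _ (by omega)
  have hdis : (∑ P ∈ V, ∑ Q ∈ V, if Disjoint P Q then 1 else 0) = N * K := by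
    rw [sum_congr rfl (fun P hP => card_disj S P (m + 1) hP), sum_const, hVc, smul_eq_mul]
  let a : Finset ℕ → Finset ℕ → ℕ := fun P Q => if Disjoint P Q ∧ ¬ good P then 1 else 0
  let b : Finset ℕ → Finset ℕ → ℕ := fun P Q =>
    if Disjoint P Q ∧ good P ∧ yf P ∈ Q then 1 else 0
  have ha : ∑ P ∈ V, ∑ Q ∈ V, a P Q = bad * K := by
    have : ∀ P ∈ V, ∑ Q ∈ V, a P Q = if ¬ good P then K else 0 := by
      intro P hP
      simp only [a]
      by_cases h : good P
      · simp [h]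
      · simp only [h, not_false_eq_true, and_true, if_true]
        exact card_disj S P (m + 1) hP
    rw [sum_congr rfl this, ← sum_filter, sum_const, smul_eq_mul]
  have hb : ∑ P ∈ V, ∑ Q ∈ V, b P Q ≤ N * c := by
    rw [← hVc, ← smul_eq_mul]
    refine sum_le_card_nsmul _ _ _ ?_
    intro P hP
    by_cases h : good P
    · have h' := hyf P h
      simp only [b, h, true_and]
      exact card_disj_mem S P (m + 1) (yf P) hP h'.1 h'.2.1
    · simp [b, h]
  have hS2 : (∑ P ∈ V, ∑ Q ∈ V, if Disjoint P Q then f P Q else 0)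
      ≤ 2 * (bad * K + N * c) := by
    calc _ ≤ ∑ P ∈ V, ∑ Q ∈ V, (a P Q + a Q P + b P Q + b Q P) := by
          refine sum_le_sum fun P _ => sum_le_sum fun Q _ => ?_
          by_cases hd : Disjoint P Q
          · rw [if_pos hd]
            by_cases hP : good P
            · by_cases hQ : good Q
              · by_cases h1 : yf P ∈ Q
                · have : b P Q = 1 := if_pos ⟨hd, hP, h1⟩
                  have : f P Q ≤ 1 := by simp only [f]; split_ifs <;> omega
                  omega
                · by_cases h2 : yf Q ∈ P
                  · have : b Q P = 1 := if_pos ⟨hd.symm, hQ, h2⟩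
                    have : f P Q ≤ 1 := by simp only [f]; split_ifs <;> omega
                    omega
                  · have hp := hyf P hP
                    have hq := hyf Q hQ
                    obtain ⟨z, hz⟩ := hI _ hp.2.2 _ hq.2.2
                    rw [mem_inter, mem_insert, mem_insert] at hz
                    have he : yf P = yf Q := by
                      rcases hz with ⟨hz1 | hz1, hz2 | hz2⟩
                      · exact hz1.symm.trans hz2
                      · exact absurd (hz1 ▸ hz2) h1
                      · exact absurd (hz2 ▸ hz1) h2
                      · exact absurd hz2 (disjoint_left.1 hd hz1)
                    have : f P Q = 0 := if_pos ⟨hP, hQ, he⟩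
                    omega
              · have : a Q P = 1 := if_pos ⟨hd.symm, hQ⟩
                have : f P Q ≤ 1 := by simp only [f]; split_ifs <;> omega
                omega
            · have : a P Q = 1 := if_pos ⟨hd, hP⟩
              have : f P Q ≤ 1 := by simp only [f]; split_ifs <;> omega
              omega
          · rw [if_neg hd]; exact Nat.zero_le _
      _ = (∑ P ∈ V, ∑ Q ∈ V, a P Q) + (∑ P ∈ V, ∑ Q ∈ V, a Q P)
          + (∑ P ∈ V, ∑ Q ∈ V, b P Q) + (∑ P ∈ V, ∑ Q ∈ V, b Q P) := by
          simp only [sum_add_distrib]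
      _ ≤ _ := by
          rw [sum_comm (f := fun P Q => a Q P), sum_comm (f := fun P Q => b Q P), ha]
          omega
  have hS1 : 34 * N ^ 2 ≤ 34 * (∑ P ∈ V, ∑ Q ∈ V, f P Q) + N * N := by
    have h1 : ∀ P ∈ V, 34 * N ≤ 34 * (∑ Q ∈ V, f P Q) + N := by
      intro P hP
      have h2 : N = ∑ Q ∈ V, f P Q
          + (V.filter fun Q => good P ∧ good Q ∧ yf P = yf Q).card := by
        rw [card_filter, ← sum_add_distrib, ← hVc, card_eq_sum_ones]
        refine sum_congr rfl fun Q _ => ?_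
        simp only [f]; split_ifs <;> rfl
      have h3 : 34 * (V.filter fun Q => good P ∧ good Q ∧ yf P = yf Q).card ≤ N := by
        by_cases h : good P
        · refine le_trans (Nat.mul_le_mul_left _ (card_le_card ?_)) (hdeg (yf P) (hyf P h).1)
          intro Q hQ
          rw [mem_filter] at hQ
          obtain ⟨hQV, _, hQg, he⟩ := hQ
          have hq := hyf Q hQg
          rw [← he] at hq
          have hQV' := mem_powersetCard.1 hQV
          exact mem_filter.2 ⟨mem_powersetCard.2 ⟨subset_erase.2 ⟨hQV'.1, hq.2.1⟩, hQV'.2⟩,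
            hq.2.2⟩
        · simp [h]
      omega
    have h2 := sum_le_sum h1
    simp only [sum_add_distrib, sum_const, hVc, smul_eq_mul] at h2
    rw [← mul_sum] at h2
    calc _ = N * (34 * N) := by ring
      _ ≤ _ := h2
  rw [hdis, hVc] at hkey
  set S1 := ∑ P ∈ V, ∑ Q ∈ V, f P Q
  have h1 : S1 * (N * K) ≤ 2 * N ^ 2 * (2 * (bad * K + N * c)) :=
    hkey.trans (Nat.mul_le_mul_left _ hS2)
  have h2 : 100 * (bad * K + N * c) ≤ 3 * N * K := by
    have e1 : 50 * bad * K ≤ N * K := Nat.mul_le_mul_right _ hbadN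
    have e2 : N * (100 * c) ≤ N * K := Nat.mul_le_mul_left _ hcK
    nlinarith
  have h3 : 100 * S1 ≤ 12 * N ^ 2 := by
    refine Nat.le_of_mul_le_mul_right (c := N * K) ?_ (by positivity)
    calc 100 * S1 * (N * K) = 100 * (S1 * (N * K)) := by ring
      _ ≤ 100 * (2 * N ^ 2 * (2 * (bad * K + N * c))) := Nat.mul_le_mul_left _ h1
      _ = 4 * N ^ 2 * (100 * (bad * K + N * c)) := by ring
      _ ≤ 4 * N ^ 2 * (3 * N * K) := Nat.mul_le_mul_left _ h2
      _ = _ := by ring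
  have h4 : 0 < N ^ 2 := by positivity
  have h5 : N * N = N ^ 2 := by ring
  omega

lemma star_eq (S : Finset ℕ) (k x : ℕ) (hx : x ∈ S) (hS : 3 * k ≤ S.card) (hk : 1 ≤ k) :
    (diffFam ((powersetCard k S).filter fun A => x ∈ A)).card
      = ∑ ℓ ∈ range k, (S.card - 1).choose ℓ := by
  have hXc : (S.erase x).card = S.card - 1 := card_erase_of_mem hx
  rw [← hXc, ← card_small]
  congr 1
  ext E
  rw [mem_small]
  constructor
  · intro hE
    obtain ⟨⟨P, Q⟩, hPQ, rfl⟩ := mem_image.1 hE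
    simp only [mem_product, mem_filter, mem_powersetCard] at hPQ ⊢
    obtain ⟨⟨⟨h1, h2⟩, h3⟩, ⟨⟨h4, h5⟩, h6⟩⟩ := hPQ
    refine ⟨subset_erase.2 ⟨sdiff_subset.trans h1, fun h => (mem_sdiff.1 h).2 h6⟩, ?_⟩
    have := sdiff_card_lt (A := P) (B := Q) ⟨x, mem_inter.2 ⟨h3, h6⟩⟩
    omega
  · rintro ⟨hE, hEk⟩
    obtain ⟨T, hT, hTc⟩ := exists_subset_card_eq (s := (S.erase x) \ E) (n := k - 1 - E.card)
      (by rw [card_sdiff_of_subset hE]; omega)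
    rw [subset_sdiff] at hT
    have hET : E ∪ T ⊆ S.erase x := union_subset hE hT.1
    have hETc : (E ∪ T).card = k - 1 := by
      rw [card_union_of_disjoint hT.2.symm]; omega
    obtain ⟨U, hU, hUc⟩ := exists_subset_card_eq (s := (S.erase x) \ (E ∪ T)) (n := E.card)
      (by rw [card_sdiff_of_subset hET]; omega)
    rw [subset_sdiff, disjoint_union_right] at hU
    have hTUc : (T ∪ U).card = k - 1 := by
      rw [card_union_of_disjoint hU.2.2.symm]; omega
    have hTU : T ∪ U ⊆ S.erase x := union_subset hT.1 hU.1
    have hx1 : x ∉ E ∪ T := fun h => (mem_erase.1 (hET h)).1 rfl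
    have hx2 : x ∉ T ∪ U := fun h => (mem_erase.1 (hTU h)).1 rfl
    refine mem_image.2 ⟨(insert x (E ∪ T), insert x (T ∪ U)), ?_, ?_⟩
    · simp only [mem_product, mem_filter, mem_powersetCard, mem_insert_self, and_true]
      refine ⟨⟨insert_subset hx (hET.trans (erase_subset _ _)), ?_⟩,
        ⟨insert_subset hx (hTU.trans (erase_subset _ _)), ?_⟩⟩
      · rw [card_insert_of_notMem hx1]; omega
      · rw [card_insert_of_notMem hx2]; omega
    · ext z
      have d1 := fun h : z ∈ E => disjoint_left.1 hT.2.symm h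
      have d2 := fun h : z ∈ E => disjoint_left.1 hU.2.1.symm h
      have d3 : z ∈ E → z ≠ x := fun h => (mem_erase.1 (hE h)).1
      simp only [mem_sdiff, mem_insert, mem_union]
      tauto

theorem stmt16 (n k : ℕ) (hk : 50 ≤ k) (hn : 50 * k * Real.log k ≤ (n : ℝ)) :
    (∀ F : Finset (Finset ℕ), F ⊆ (Finset.Icc 1 n).powersetCard k → Intersecting F →
      (diffFam F).card ≤ ∑ ℓ ∈ Finset.range k, (n - 1).choose ℓ) ∧
    (∀ x ∈ Finset.Icc 1 n,
      (diffFam (fullStar n k x)).card = ∑ ℓ ∈ Finset.range k, (n - 1).choose ℓ) := by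
  have hc : (Finset.Icc 1 n).card = n := by simp
  set L := Nat.log 2 k with hLdef
  have hL : 5 ≤ L := by
    rw [hLdef]
    exact (Nat.le_log_iff_pow_le (by norm_num) (by omega)).2 (by omega)
  have hkL : k < 2 ^ (L + 1) := Nat.lt_pow_succ_log_self (by norm_num) k
  have hpow : 2 ^ L ≤ k := Nat.pow_log_le_self 2 (by omega)
  have hLk : L ≤ k := (Nat.lt_two_pow_self).le.trans hpow
  have hnL : 34 * k * L ≤ n := by
    have h1 : (L : ℝ) * Real.log 2 ≤ Real.log k := by
      rw [← Real.log_pow]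
      apply Real.log_le_log (by positivity)
      exact_mod_cast hpow
    have h2 := Real.log_two_gt_d9
    have h3 : (34 * k * L : ℝ) ≤ n := by
      have hLp : (0 : ℝ) ≤ L := by positivity
      have hkp : (0 : ℝ) ≤ k := by positivity
      have h4 : 34 * (L : ℝ) ≤ 50 * Real.log k := by nlinarith
      nlinarith
    exact_mod_cast h3
  have hn170 : 170 * k ≤ n := by nlinarith
  refine ⟨?_, ?_⟩
  · intro F hF hI
    by_cases h : ∃ x ∈ Finset.Icc 1 n,
        (F.filter fun A => x ∉ A).card < (n - 1 - L).choose (k - L)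
    · obtain ⟨x, hx, h⟩ := h
      have := case_one' (Finset.Icc 1 n) k x L hk (by omega) hL hLk hkL hx F hF hI
        (by rw [hc]; exact h)
      rwa [hc] at this
    · push Not at h
      have := case_two (Finset.Icc 1 n) k L hk (by omega) hL hLk F hF hI
        (by rw [hc]; exact h)
      rwa [hc] at this
  · intro x hx
    have := star_eq (Finset.Icc 1 n) k x hx (by omega) (by omega)
    rwa [hc] at this
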